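/- Let K be a field, q ∈ K nonzero, and n > t positive integers. Define i*_q : O_q(M_n^{≤t,°}) ⊗ O_q(GL_t) → O_q(V°) as the composition (id ⊗ m) ∘ (μ°*_q ⊗ id), where m : O_q(M_{t,n}°) ⊗ O_q(GL_t) → O_q(M_{t,n}°) is multiplication via the embedding of O_q(GL_t) in O_q(M_{t,n}°), and define j*_q : O_q(V°) → O_q(M_n^{≤t,°}) ⊗ O_q(GL_t) by j*_q(a ⊗ b) = Σ b_0 S^{−1}(b_{−1}) a_0 ⊗ S(a_1) b_{−2}. Then the composition i*_q ∘ j*_q is the identity map on O_q(V°). -/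

import Mathlib

open scoped TensorProduct

noncomputable section

/-- The four defining relations of the quantized coordinate ring `O_q(M_{u,v})`, as a relation
on the free algebra on generators `X_{ij}`, `(i,j) ∈ Fin u × Fin v`. -/
inductive QMRel (K : Type) [Field K] (q : K) (u v : ℕ) :
    FreeAlgebra K (Fin u × Fin v) → FreeAlgebra K (Fin u × Fin v) → Prop
  | row {i : Fin u} {j k : Fin v} (h : j < k) :
      QMRel K q u v (FreeAlgebra.ι K (i, j) * FreeAlgebra.ι K (i, k))
        (q • (FreeAlgebra.ι K (i, k) * FreeAlgebra.ι K (i, j)))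
  | col {i k : Fin u} {j : Fin v} (h : i < k) :
      QMRel K q u v (FreeAlgebra.ι K (i, j) * FreeAlgebra.ι K (k, j))
        (q • (FreeAlgebra.ι K (k, j) * FreeAlgebra.ι K (i, j)))
  | comm {i k : Fin u} {j l : Fin v} (h1 : i < k) (h2 : l < j) :
      QMRel K q u v (FreeAlgebra.ι K (i, j) * FreeAlgebra.ι K (k, l))
        (FreeAlgebra.ι K (k, l) * FreeAlgebra.ι K (i, j))
  | quantum {i k : Fin u} {j l : Fin v} (h1 : i < k) (h2 : j < l) :
      QMRel K q u v (FreeAlgebra.ι K (i, j) * FreeAlgebra.ι K (k, l))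
        (FreeAlgebra.ι K (k, l) * FreeAlgebra.ι K (i, j) +
          (q - q⁻¹) • (FreeAlgebra.ι K (i, l) * FreeAlgebra.ι K (k, j)))

/-- The quantized coordinate ring `O_q(M_{u,v})` of `u × v` matrices. -/
abbrev OqM (K : Type) [Field K] (q : K) (u v : ℕ) :=
  RingQuot (QMRel K q u v)

/-- The canonical generators `X_{ij}` of `O_q(M_{u,v})`. -/
def Xg (K : Type) [Field K] (q : K) {u v : ℕ} (i : Fin u) (j : Fin v) : OqM K q u v :=
  RingQuot.mkAlgHom K (QMRel K q u v) (FreeAlgebra.ι K (i, j))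

/-- The number of inversions (the length) of a permutation of `Fin l`. -/
def invCount {l : ℕ} (σ : Equiv.Perm (Fin l)) : ℕ :=
  (Finset.univ.filter fun p : Fin l × Fin l => p.1 < p.2 ∧ σ p.2 < σ p.1).card

/-- The `l × l` quantum minor of `O_q(M_{u,v})` with rows `R 0, …, R (l-1)` and columns
`C 0, …, C (l-1)`:  `[R|C] = Σ_σ (-q)^{ℓ(σ)} X_{R 0, C (σ 0)} ⋯ X_{R (l-1), C (σ (l-1))}`. -/
def qMinor (K : Type) [Field K] (q : K) {u v l : ℕ} (R : Fin l → Fin u) (C : Fin l → Fin v) :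
    OqM K q u v :=
  ∑ σ : Equiv.Perm (Fin l),
    ((-q) ^ invCount σ) • (List.ofFn fun i : Fin l => Xg K q (R i) (C (σ i))).prod

/-- The relations killing all `(t+1) × (t+1)` quantum minors of `O_q(M_{m,n})`. -/
inductive DetRel (K : Type) [Field K] (q : K) (m n t : ℕ) :
    OqM K q m n → OqM K q m n → Prop
  | minor (R : Fin (t + 1) → Fin m) (C : Fin (t + 1) → Fin n)
      (hR : StrictMono R) (hC : StrictMono C) :
      DetRel K q m n t (qMinor K q R C) 0

/-- `O_q(M_{m,n}^{≤ t}) = O_q(M_{m,n}) / I_{t+1}`, the quotient by the ideal generated by all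
`(t+1) × (t+1)` quantum minors. -/
abbrev OqMle (K : Type) [Field K] (q : K) (m n t : ℕ) :=
  RingQuot (DetRel K q m n t)

/-- The quotient map `O_q(M_{m,n}) → O_q(M_{m,n}^{≤ t})`. -/
def mkle (K : Type) [Field K] (q : K) (m n t : ℕ) :
    OqM K q m n →ₐ[K] OqMle K q m n t :=
  RingQuot.mkAlgHom K (DetRel K q m n t)

/-- The two-sided ideal of a `K`-algebra `R` generated by a subset `S`, as a set. -/
def tsSpan (K : Type) [Field K] (R : Type) [Ring R] [Algebra K R] (S : Set R) : Set R :=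
  (Submodule.span K {x : R | ∃ a b : R, ∃ s ∈ S, x = a * s * b} : Submodule K R)

/-- The left `H`-comodule structure map `γ* : A ⊗ B → H ⊗ (A ⊗ B)` given on pure tensors by
`γ*(a ⊗ b) = Σ S(a₁) b₋₁ ⊗ a₀ ⊗ b₀`, built from a right coaction `ρ* : A → A ⊗ H`, a left
coaction `λ* : B → H ⊗ B`, and the antipode `S` of `H`. -/
def gammaMap (K A B H : Type) [Field K] [Ring A] [Algebra K A] [Ring B] [Algebra K B]
    [Ring H] [HopfAlgebra K H]
    (ρ : A →ₐ[K] A ⊗[K] H) (lam : B →ₐ[K] H ⊗[K] B) :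
    (A ⊗[K] B) →ₗ[K] H ⊗[K] (A ⊗[K] B) :=
  (TensorProduct.map
      ((LinearMap.mul' K H).comp
        (TensorProduct.map (HopfAlgebra.antipode (R := K)) LinearMap.id))
      LinearMap.id)
    ∘ₗ (TensorProduct.tensorTensorTensorComm K H A H B).toLinearMap
    ∘ₗ (TensorProduct.map (TensorProduct.comm K A H).toLinearMap LinearMap.id)
    ∘ₗ (TensorProduct.map ρ.toLinearMap lam.toLinearMap)

/-- The quantum determinant `d_T` of `O_q(M_t)`. -/
def qdet (K : Type) [Field K] (q : K) (t : ℕ) : OqM K q t t :=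
  qMinor K q (id : Fin t → Fin t) (id : Fin t → Fin t)

/-- The rows `{n-t+1, …, n}` (the lowest `t` rows). -/
def rowTop (n t : ℕ) (h : t ≤ n) : Fin t → Fin n :=
  fun i => ⟨n - t + i.1, by have := i.2; omega⟩

/-- The columns `{1, …, t}` (the leftmost `t` columns). -/
def colLeft (n t : ℕ) (h : t ≤ n) : Fin t → Fin n :=
  fun i => ⟨i.1, by have := i.2; omega⟩

/-- `d_Y = [n,…,n-t+1 | 1,…,t] ∈ O_q(M_{n,t})`. -/
def dY (K : Type) [Field K] (q : K) (n t : ℕ) (h : t ≤ n) : OqM K q n t :=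
  qMinor K q (rowTop n t h) (id : Fin t → Fin t)

/-- `d_Z = [t,…,1 | 1,…,t] ∈ O_q(M_{t,n})`. -/
def dZ (K : Type) [Field K] (q : K) (n t : ℕ) (h : t ≤ n) : OqM K q t n :=
  qMinor K q (id : Fin t → Fin t) (colLeft n t h)

/-- `d_X = [n,…,n-t+1 | 1,…,t] ∈ O_q(M_n)`. -/
def dX (K : Type) [Field K] (q : K) (n t : ℕ) (h : t ≤ n) : OqM K q n n :=
  qMinor K q (rowTop n t h) (colLeft n t h)

/-- `d_x = d_X + I_{t+1} ∈ O_q(M_n^{≤ t})`. -/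
def dx (K : Type) [Field K] (q : K) (n t : ℕ) (h : t ≤ n) : OqMle K q n n t :=
  mkle K q n n t (dX K q n t h)

/-- The map `j*_q : O_q(V°) → O_q(M_n^{≤t,°}) ⊗ O_q(GL_t)`, given on pure tensors by
`j*_q(a ⊗ b) = Σ b₀ S⁻¹(b₋₁) a₀ ⊗ S(a₁) b₋₂`, where `ρ°*_q(a) = Σ a₀ ⊗ a₁` and
`(Δ ⊗ id) λ°*_q(b) = Σ b₋₂ ⊗ b₋₁ ⊗ b₀`, the products in the first factor being taken in
`O_q(M_n^{≤t,°})` via the lower-left-corner embeddings `eA`, `eZ`, `eG`. -/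
def jMap (K G Ao Zo Xo : Type) [Field K] [Ring G] [HopfAlgebra K G]
    [Ring Ao] [Algebra K Ao] [Ring Zo] [Algebra K Zo] [Ring Xo] [Algebra K Xo]
    (ρo : Ao →ₐ[K] Ao ⊗[K] G) (lamo : Zo →ₐ[K] G ⊗[K] Zo)
    (eA : Ao →ₐ[K] Xo) (eZ : Zo →ₐ[K] Xo) (eG : G →ₐ[K] Xo) (Sinv : G →ₗ[K] G) :
    (Ao ⊗[K] Zo) →ₗ[K] Xo ⊗[K] G :=
  -- multiply out the first factor `(b₀ ⊗ b₋₁) ⊗ a₀ ↦ eZ b₀ * eG (S⁻¹ b₋₁) * eA a₀` …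
  (TensorProduct.map
      ((LinearMap.mul' K Xo).comp
        (TensorProduct.map
          ((LinearMap.mul' K Xo).comp
            (TensorProduct.map eZ.toLinearMap (eG.toLinearMap ∘ₗ Sinv)))
          eA.toLinearMap))
      -- … and the second factor `a₁ ⊗ b₋₂ ↦ S(a₁) * b₋₂`
      ((LinearMap.mul' K G).comp
        (TensorProduct.map (HopfAlgebra.antipode (R := K)) LinearMap.id)))
    ∘ₗ (TensorProduct.comm K (G ⊗[K] G) ((Zo ⊗[K] G) ⊗[K] Ao)).toLinearMap
    ∘ₗ (TensorProduct.map (TensorProduct.comm K G G).toLinearMap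
          ((TensorProduct.comm K Ao (Zo ⊗[K] G)).toLinearMap
            ∘ₗ (TensorProduct.leftComm K Zo Ao G).toLinearMap
            ∘ₗ (TensorProduct.comm K (Ao ⊗[K] G) Zo).toLinearMap))
    ∘ₗ (TensorProduct.tensorTensorTensorComm K G (Ao ⊗[K] G) G Zo).toLinearMap
    ∘ₗ (TensorProduct.map (TensorProduct.leftComm K Ao G G).toLinearMap LinearMap.id)
    ∘ₗ (TensorProduct.tensorTensorTensorComm K Ao G (G ⊗[K] G) Zo).toLinearMap
    ∘ₗ (TensorProduct.map ρo.toLinearMap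
          ((TensorProduct.map (Coalgebra.comul (R := K)) LinearMap.id) ∘ₗ lamo.toLinearMap))

/-- The map `i*_q : O_q(M_n^{≤t,°}) ⊗ O_q(GL_t) → O_q(V°)`, the composition
`(id ⊗ m) ∘ (μ°*_q ⊗ id)` where `m` is multiplication on `O_q(M_{t,n}°)` via the embedding
`eGZ : O_q(GL_t) → O_q(M_{t,n}°)`. -/
def iMap (K G Ao Zo Xo : Type) [Field K] [Ring G] [HopfAlgebra K G]
    [Ring Ao] [Algebra K Ao] [Ring Zo] [Algebra K Zo] [Ring Xo] [Algebra K Xo]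
    (μo : Xo →ₐ[K] Ao ⊗[K] Zo) (eGZ : G →ₐ[K] Zo) :
    (Xo ⊗[K] G) →ₗ[K] Ao ⊗[K] Zo :=
  (TensorProduct.map LinearMap.id
      ((LinearMap.mul' K Zo).comp (TensorProduct.map LinearMap.id eGZ.toLinearMap)))
    ∘ₗ (TensorProduct.assoc K Ao Zo G).toLinearMap
    ∘ₗ (TensorProduct.map μo.toLinearMap LinearMap.id)

section Generators

variable {K : Type} [Field K] {q : K} {u v : ℕ}

theorem OqM.algHom_ext {C : Type} [Ring C] [Algebra K C] {f g : OqM K q u v →ₐ[K] C}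
    (h : ∀ i j, f (Xg K q i j) = g (Xg K q i j)) : f = g := by
  apply RingQuot.ringQuot_ext'
  apply FreeAlgebra.hom_ext
  funext p
  exact h p.1 p.2

/-- Two algebra maps out of a localization agree as soon as they agree on generators. -/
theorem localization_algHom_ext {A : Type} [Ring A] [Algebra K A] {ι : OqM K q u v →ₐ[K] A}
    {d : OqM K q u v} (hd : IsUnit (ι d))
    (huniv : ∀ (C : Type) [Ring C] [Algebra K C] (f : OqM K q u v →ₐ[K] C),
      IsUnit (f d) → ∃! g : A →ₐ[K] C, g.comp ι = f)
    {C : Type} [Ring C] [Algebra K C] {f g : A →ₐ[K] C}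
    (h : ∀ i j, f (ι (Xg K q i j)) = g (ι (Xg K q i j))) : f = g :=
  (huniv C (g.comp ι) (hd.map g)).unique (OqM.algHom_ext h) rfl

/-- Relabelling the rows along a strictly monotone map. -/
def OqM.mapRows (K : Type) [Field K] (q : K) {u u' : ℕ} (v : ℕ) (r : Fin u → Fin u')
    (hr : StrictMono r) : OqM K q u v →ₐ[K] OqM K q u' v :=
  RingQuot.liftAlgHom K ⟨FreeAlgebra.lift K fun p => Xg K q (r p.1) p.2, by
    intro x y h
    cases h with
    | row h =>
      simpa [Xg] using RingQuot.mkAlgHom_rel K (QMRel.row (K := K) (q := q) h)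
    | col h =>
      simpa [Xg] using RingQuot.mkAlgHom_rel K (QMRel.col (K := K) (q := q) (hr h))
    | comm h1 h2 =>
      simpa [Xg] using RingQuot.mkAlgHom_rel K (QMRel.comm (K := K) (q := q) (hr h1) h2)
    | quantum h1 h2 =>
      simpa [Xg] using RingQuot.mkAlgHom_rel K (QMRel.quantum (K := K) (q := q) (hr h1) h2)⟩

@[simp]
theorem OqM.mapRows_Xg {u u' : ℕ} (r : Fin u → Fin u') (hr : StrictMono r) (i : Fin u)
    (j : Fin v) : OqM.mapRows K q v r hr (Xg K q i j) = Xg K q (r i) j := by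
  rw [OqM.mapRows, Xg, RingQuot.liftAlgHom_mkAlgHom_apply, FreeAlgebra.lift_ι_apply]

theorem OqM.mapRows_qMinor {u u' l : ℕ} (r : Fin u → Fin u') (hr : StrictMono r)
    (R : Fin l → Fin u) (C : Fin l → Fin v) :
    OqM.mapRows K q v r hr (qMinor K q R C) = qMinor K q (r ∘ R) C := by
  simp [qMinor, map_sum, map_list_prod, List.map_ofFn, Function.comp_def]

theorem rowTop_strictMono (n t : ℕ) (h : t ≤ n) : StrictMono (rowTop n t h) :=
  fun _ _ hij => Nat.add_lt_add_left hij _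

end Generators

section ConvolutionAction

variable {K A G V : Type} [Field K] [Ring A] [Algebra K A] [Ring G] [Algebra K G]
  [Ring V] [Algebra K V]

/-- For `ρ a = Σ a₀ ⊗ a₁`, the linear map `a ↦ Σ f a₀ * g a₁`. -/
def convAct (ρ : A →ₗ[K] A ⊗[K] G) (f : A →ₗ[K] V) (g : G →ₗ[K] V) : A →ₗ[K] V :=
  LinearMap.mul' K V ∘ₗ TensorProduct.map f g ∘ₗ ρ

theorem convAct_convAct {ρ : A →ₗ[K] A ⊗[K] G} {Δ : G →ₗ[K] G ⊗[K] G}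
    (h : ∀ a, TensorProduct.assoc K A G G (ρ.rTensor G (ρ a)) = Δ.lTensor A (ρ a))
    (f : A →ₗ[K] V) (g g' : G →ₗ[K] V) :
    convAct ρ (convAct ρ f g) g' = convAct ρ f (convAct Δ g g') := by
  have hl : ∀ x : A ⊗[K] G, LinearMap.mul' K V (TensorProduct.map (convAct ρ f g) g' x) =
      LinearMap.mul' K V (TensorProduct.map f (LinearMap.mul' K V ∘ₗ TensorProduct.map g g')
        (TensorProduct.assoc K A G G (ρ.rTensor G x))) := by
    intro x
    induction x with
    | zero => simp
    | add x y hx hy => simp only [map_add, hx, hy]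
    | tmul a c =>
      simp only [convAct, TensorProduct.map_tmul, LinearMap.rTensor_tmul, LinearMap.comp_apply,
        LinearMap.mul'_apply]
      induction ρ a with
      | zero => simp
      | add x y hx hy => simp only [map_add, add_mul, TensorProduct.add_tmul, hx, hy]
      | tmul a b => simp [mul_assoc]
  have hr : ∀ x : A ⊗[K] G, LinearMap.mul' K V (TensorProduct.map f (convAct Δ g g') x) =
      LinearMap.mul' K V (TensorProduct.map f (LinearMap.mul' K V ∘ₗ TensorProduct.map g g')
        (Δ.lTensor A x)) := by
    intro x
    induction x with
    | zero => simp
    | add x y hx hy => simp only [map_add, hx, hy]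
    | tmul a c => simp [convAct]
  ext a
  exact (hl (ρ a)).trans ((congrArg _ (congrArg _ (h a))).trans (hr (ρ a)).symm)

theorem convAct_counit {ρ : A →ₗ[K] A ⊗[K] G} {ε : G →ₗ[K] K}
    (h : ∀ a, ε.lTensor A (ρ a) = a ⊗ₜ[K] 1) (f : A →ₗ[K] V) :
    convAct ρ f (Algebra.linearMap K V ∘ₗ ε) = f := by
  have hx : ∀ x : A ⊗[K] G,
      LinearMap.mul' K V (TensorProduct.map f (Algebra.linearMap K V ∘ₗ ε) x) =
      LinearMap.mul' K V (TensorProduct.map f (Algebra.linearMap K V) (ε.lTensor A x)) := by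
    intro x
    induction x with
    | zero => simp
    | add x y hx hy => simp only [map_add, hx, hy]
    | tmul a c => simp
  ext a
  refine (hx (ρ a)).trans ?_
  simp [h a]

theorem algHom_comp_convAct {W : Type} [Ring W] [Algebra K W] (φ : V →ₐ[K] W)
    (ρ : A →ₗ[K] A ⊗[K] G) (f : A →ₗ[K] V) (g : G →ₗ[K] V) :
    φ.toLinearMap ∘ₗ convAct ρ f g = convAct ρ (φ.toLinearMap ∘ₗ f) (φ.toLinearMap ∘ₗ g) := by
  ext a
  simp only [convAct, LinearMap.comp_apply]
  induction ρ a with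
  | zero => simp
  | add x y hx hy => simp only [map_add, hx, hy]
  | tmul a c => simp

/-- The flip of a left coaction, a right coaction for the flipped comultiplication. -/
def flipCoact {H : Type} [Ring H] [Algebra K H] (lam : A →ₗ[K] H ⊗[K] A) : A →ₗ[K] A ⊗[K] H :=
  (TensorProduct.comm K H A).toLinearMap ∘ₗ lam

theorem flipCoact_coassoc {lam : A →ₗ[K] G ⊗[K] A} {Δ : G →ₗ[K] G ⊗[K] G}
    (h : ∀ a, TensorProduct.assoc K G G A (Δ.rTensor A (lam a)) = lam.lTensor G (lam a)) (a : A) :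
    TensorProduct.assoc K A G G ((flipCoact lam).rTensor G (flipCoact lam a)) =
      (flipCoact Δ).lTensor A (flipCoact lam a) := by
  -- both sides are the image of the coassociativity identity under the order reversal
  let r : G ⊗[K] (G ⊗[K] A) →ₗ[K] A ⊗[K] (G ⊗[K] G) :=
    (TensorProduct.assoc K A G G).toLinearMap ∘ₗ
      (TensorProduct.map (TensorProduct.comm K G A).toLinearMap LinearMap.id) ∘ₗ
      (TensorProduct.comm K G (G ⊗[K] A)).toLinearMap
  have hl : ∀ x : G ⊗[K] A, TensorProduct.assoc K A G G
      ((flipCoact lam).rTensor G (TensorProduct.comm K G A x)) = r (lam.lTensor G x) := by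
    intro x
    induction x with
    | zero => simp
    | add x y hx hy => simp only [map_add, hx, hy]
    | tmul g a => simp [r, flipCoact]
  have hr : ∀ x : G ⊗[K] A, (flipCoact Δ).lTensor A (TensorProduct.comm K G A x) =
      r (TensorProduct.assoc K G G A (Δ.rTensor A x)) := by
    intro x
    induction x with
    | zero => simp
    | add x y hx hy => simp only [map_add, hx, hy]
    | tmul g a =>
      simp only [TensorProduct.comm_tmul, LinearMap.lTensor_tmul, LinearMap.rTensor_tmul,
        flipCoact, LinearMap.comp_apply, LinearEquiv.coe_coe]
      induction Δ g with
      | zero => simp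
      | add x y hx hy => simp only [map_add, TensorProduct.add_tmul, TensorProduct.tmul_add, hx, hy]
      | tmul b c => simp [r]
  exact (hl (lam a)).trans ((congrArg r (h a).symm).trans (hr (lam a)).symm)

theorem flipCoact_counit {lam : A →ₗ[K] G ⊗[K] A} {ε : G →ₗ[K] K}
    (h : ∀ a, ε.rTensor A (lam a) = 1 ⊗ₜ[K] a) (a : A) :
    ε.lTensor A (flipCoact lam a) = a ⊗ₜ[K] 1 := by
  rw [← TensorProduct.comm_tmul, ← h a]
  simp only [flipCoact, LinearMap.comp_apply, LinearEquiv.coe_coe]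
  induction lam a with
  | zero => simp
  | add x y hx hy => simp only [map_add, hx, hy]
  | tmul g a => simp

end ConvolutionAction

section InverseAntipode

open Coalgebra HopfAlgebra

variable {K G : Type} [Field K] [Ring G] [HopfAlgebra K G]

/-- `Σ h₂ S⁻¹(h₁) = ε(h)`. -/
theorem convAct_flip_id_antipodeInv {Sinv : G →ₗ[K] G}
    (hSinv : ∀ g : G, Sinv (antipode K g) = g ∧ antipode K (Sinv g) = g) :
    convAct (flipCoact (comul (R := K) (A := G))) LinearMap.id Sinv =
      Algebra.linearMap K G ∘ₗ counit := by
  have inj : Function.Injective (antipode K (A := G)) :=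
    Function.LeftInverse.injective fun g => (hSinv g).1
  ext h
  apply inj
  have := mul_antipode_lTensor_comul_apply (R := K) h
  have e : ∀ x : G ⊗[K] G, antipode K (LinearMap.mul' K G (TensorProduct.map LinearMap.id Sinv
      (TensorProduct.comm K G G x))) = LinearMap.mul' K G ((antipode K).lTensor G x) := by
    intro x
    induction x with
    | zero => simp
    | add x y hx hy => simp only [map_add, hx, hy]
    | tmul g a => simp [antipode_mul_antidistrib, (hSinv _).2]
  simpa [Algebra.algebraMap_eq_smul_one, convAct, flipCoact] using (e (comul h)).trans this

/-- `Σ S⁻¹(h₂) h₁ = ε(h)`. -/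
theorem convAct_flip_antipodeInv_id {Sinv : G →ₗ[K] G}
    (hSinv : ∀ g : G, Sinv (antipode K g) = g ∧ antipode K (Sinv g) = g) :
    convAct (flipCoact (comul (R := K) (A := G))) Sinv LinearMap.id =
      Algebra.linearMap K G ∘ₗ counit := by
  have inj : Function.Injective (antipode K (A := G)) :=
    Function.LeftInverse.injective fun g => (hSinv g).1
  ext h
  apply inj
  have := mul_antipode_rTensor_comul_apply (R := K) h
  have e : ∀ x : G ⊗[K] G, antipode K (LinearMap.mul' K G (TensorProduct.map Sinv LinearMap.id
      (TensorProduct.comm K G G x))) = LinearMap.mul' K G ((antipode K).rTensor G x) := by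
    intro x
    induction x with
    | zero => simp
    | add x y hx hy => simp only [map_add, hx, hy]
    | tmul g a => simp [antipode_mul_antidistrib, (hSinv _).2]
  simpa [Algebra.algebraMap_eq_smul_one, convAct, flipCoact] using (e (comul h)).trans this

end InverseAntipode

section Composition

open Coalgebra HopfAlgebra Algebra.TensorProduct

variable {K G Ao Zo Xo : Type} [Field K] [Ring G] [HopfAlgebra K G]
  [Ring Ao] [Algebra K Ao] [Ring Zo] [Algebra K Zo] [Ring Xo] [Algebra K Xo]

theorem iMap_tmul (μo : Xo →ₐ[K] Ao ⊗[K] Zo) (eGZ : G →ₐ[K] Zo) (x : Xo) (g : G) :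
    iMap K G Ao Zo Xo μo eGZ (x ⊗ₜ g) = μo x * (1 ⊗ₜ eGZ g) := by
  simp only [iMap, LinearMap.comp_apply, TensorProduct.map_tmul, AlgHom.toLinearMap_apply,
    LinearEquiv.coe_coe, LinearMap.id_apply]
  induction μo x with
  | zero => simp
  | add x y hx hy => simp only [map_add, add_mul, TensorProduct.add_tmul, hx, hy]
  | tmul a b => simp

/-- `i (j (a ⊗ b)) = Σ μ(b₀) μ(S⁻¹ b₋₁) μ(a₀) (1 ⊗ S(a₁)) (1 ⊗ b₋₂)`, provided that
`Σ μ(a₀) (1 ⊗ S(a₁)) = a ⊗ 1`. -/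
theorem iMap_jMap_tmul (ρo : Ao →ₐ[K] Ao ⊗[K] G) (lamo : Zo →ₐ[K] G ⊗[K] Zo)
    (μo : Xo →ₐ[K] Ao ⊗[K] Zo) (eA : Ao →ₐ[K] Xo) (eZ : Zo →ₐ[K] Xo) (eG : G →ₐ[K] Xo)
    (Sinv : G →ₗ[K] G) (eGZ : G →ₐ[K] Zo)
    (hA : convAct ρo.toLinearMap (μo.comp eA).toLinearMap
        ((includeRight.comp eGZ).toLinearMap ∘ₗ antipode K) =
      (includeLeft : Ao →ₐ[K] Ao ⊗[K] Zo).toLinearMap) (a : Ao) (b : Zo) :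
    iMap K G Ao Zo Xo μo eGZ (jMap K G Ao Zo Xo ρo lamo eA eZ eG Sinv (a ⊗ₜ b)) =
      convAct (flipCoact lamo.toLinearMap) (μo.comp eZ).toLinearMap
        (convAct (flipCoact comul) ((μo.comp eG).toLinearMap ∘ₗ Sinv)
          (includeRight.comp eGZ).toLinearMap) b * (a ⊗ₜ 1) := by
  let J : (Ao ⊗[K] G) ⊗[K] ((G ⊗[K] G) ⊗[K] Zo) →ₗ[K] Xo ⊗[K] G :=
    (TensorProduct.map
      ((LinearMap.mul' K Xo).comp
        (TensorProduct.map
          ((LinearMap.mul' K Xo).comp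
            (TensorProduct.map eZ.toLinearMap (eG.toLinearMap ∘ₗ Sinv)))
          eA.toLinearMap))
      ((LinearMap.mul' K G).comp (TensorProduct.map (antipode K) LinearMap.id)))
    ∘ₗ (TensorProduct.comm K (G ⊗[K] G) ((Zo ⊗[K] G) ⊗[K] Ao)).toLinearMap
    ∘ₗ (TensorProduct.map (TensorProduct.comm K G G).toLinearMap
          ((TensorProduct.comm K Ao (Zo ⊗[K] G)).toLinearMap
            ∘ₗ (TensorProduct.leftComm K Zo Ao G).toLinearMap
            ∘ₗ (TensorProduct.comm K (Ao ⊗[K] G) Zo).toLinearMap))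
    ∘ₗ (TensorProduct.tensorTensorTensorComm K G (Ao ⊗[K] G) G Zo).toLinearMap
    ∘ₗ (TensorProduct.map (TensorProduct.leftComm K Ao G G).toLinearMap LinearMap.id)
    ∘ₗ (TensorProduct.tensorTensorTensorComm K Ao G (G ⊗[K] G) Zo).toLinearMap
  have hJ : jMap K G Ao Zo Xo ρo lamo eA eZ eG Sinv (a ⊗ₜ b) =
      J (ρo a ⊗ₜ comul.rTensor Zo (lamo b)) := rfl
  have hJt (a g h k z) : J ((a ⊗ₜ g) ⊗ₜ ((h ⊗ₜ k) ⊗ₜ z)) =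
      (eZ z * eG (Sinv k) * eA a) ⊗ₜ (antipode K g * h) := by
    simp [J]
  clear_value J
  have hx : ∀ (x : Ao ⊗[K] G) (h k : G) (z : Zo),
      iMap K G Ao Zo Xo μo eGZ (J (x ⊗ₜ ((h ⊗ₜ k) ⊗ₜ z))) =
        μo (eZ z) * μo (eG (Sinv k)) * (LinearMap.mul' K (Ao ⊗[K] Zo) (TensorProduct.map
          (μo.comp eA).toLinearMap ((includeRight.comp eGZ).toLinearMap ∘ₗ antipode K) x)) *
          (1 ⊗ₜ eGZ h) := by
    intro x h k z
    induction x with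
    | zero => simp
    | add x y hx hy => simp only [map_add, TensorProduct.add_tmul, mul_add, add_mul, hx, hy]
    | tmul a g => simp [hJt, iMap_tmul, mul_assoc]
  have hρ : LinearMap.mul' K (Ao ⊗[K] Zo) (TensorProduct.map (μo.comp eA).toLinearMap
      ((includeRight.comp eGZ).toLinearMap ∘ₗ antipode K) (ρo a)) = a ⊗ₜ 1 :=
    LinearMap.congr_fun hA a
  rw [hJ]
  simp only [convAct, flipCoact, LinearMap.comp_apply, LinearEquiv.coe_coe,
    AlgHom.toLinearMap_apply]
  induction lamo b with
  | zero => simp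
  | add x y hx hy => simp only [map_add, TensorProduct.tmul_add, add_mul, hx, hy]
  | tmul g z =>
    simp only [LinearMap.rTensor_tmul, TensorProduct.comm_tmul, TensorProduct.map_tmul,
      LinearMap.comp_apply, LinearEquiv.coe_coe, LinearMap.mul'_apply]
    induction comul (R := K) g with
    | zero => simp
    | add x y hx hy =>
      simp only [map_add, TensorProduct.tmul_add, TensorProduct.add_tmul, mul_add, add_mul, hx, hy]
    | tmul h k =>
      rw [hx, hρ]
      simp [mul_assoc]

/-- The composition `i ∘ j` is the identity as soon as `μ` restricts on the three corner
subalgebras to the coactions and the comultiplication. -/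
theorem iMap_jMap (ρo : Ao →ₐ[K] Ao ⊗[K] G) (lamo : Zo →ₐ[K] G ⊗[K] Zo)
    (μo : Xo →ₐ[K] Ao ⊗[K] Zo) (eA : Ao →ₐ[K] Xo) (eZ : Zo →ₐ[K] Xo) (eG : G →ₐ[K] Xo)
    (Sinv : G →ₗ[K] G) (eGY : G →ₐ[K] Ao) (eGZ : G →ₐ[K] Zo)
    (hSinv : ∀ g : G, Sinv (antipode K g) = g ∧ antipode K (Sinv g) = g)
    (hρ : ∀ a, TensorProduct.assoc K Ao G G (ρo.toLinearMap.rTensor G (ρo a)) =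
      comul.lTensor Ao (ρo a))
    (hρε : ∀ a, counit.lTensor Ao (ρo a) = a ⊗ₜ[K] (1 : K))
    (hlam : ∀ b, TensorProduct.assoc K G G Zo (comul.rTensor Zo (lamo b)) =
      lamo.toLinearMap.lTensor G (lamo b))
    (hlamε : ∀ b, counit.rTensor Zo (lamo b) = (1 : K) ⊗ₜ[K] b)
    (hA : μo.comp eA = (Algebra.TensorProduct.map (AlgHom.id K Ao) eGZ).comp ρo)
    (hZ : μo.comp eZ = (Algebra.TensorProduct.map eGY (AlgHom.id K Zo)).comp lamo)
    (hG : μo.comp eG = (Algebra.TensorProduct.map eGY eGZ).comp (Bialgebra.comulAlgHom K G))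
    (v : Ao ⊗[K] Zo) :
    iMap K G Ao Zo Xo μo eGZ (jMap K G Ao Zo Xo ρo lamo eA eZ eG Sinv v) = v := by
  let κ : Ao →ₐ[K] Ao ⊗[K] Zo := includeLeft
  let ι : Zo →ₐ[K] Ao ⊗[K] Zo := includeRight
  let ζ : G →ₐ[K] Ao ⊗[K] Zo := includeRight.comp eGZ
  let α : G →ₐ[K] Ao ⊗[K] Zo := includeLeft.comp eGY
  let φ : G →ₐ[K] Ao ⊗[K] Zo := μo.comp eG
  let L := flipCoact lamo.toLinearMap
  have compη (f : G →ₐ[K] Ao ⊗[K] Zo) : f.toLinearMap ∘ₗ Algebra.linearMap K G ∘ₗ counit =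
      Algebra.linearMap K (Ao ⊗[K] Zo) ∘ₗ (counit : G →ₗ[K] K) := by
    ext g; simp
  have hA' : (μo.comp eA).toLinearMap =
      convAct ρo.toLinearMap κ.toLinearMap ζ.toLinearMap := by
    rw [hA]
    ext a
    simp only [convAct, LinearMap.comp_apply, AlgHom.toLinearMap_apply, AlgHom.comp_apply]
    induction ρo a with
    | zero => simp
    | add x y hx hy => simp only [map_add, hx, hy]
    | tmul a g => simp [κ, ζ]
  have hZ' : (μo.comp eZ).toLinearMap = convAct L ι.toLinearMap α.toLinearMap := by
    rw [hZ]
    ext b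
    simp only [L, flipCoact, convAct, LinearMap.comp_apply, AlgHom.toLinearMap_apply,
      AlgHom.comp_apply]
    induction lamo b with
    | zero => simp
    | add x y hx hy => simp only [map_add, hx, hy]
    | tmul g b => simp [ι, α]
  have hG' : φ.toLinearMap = convAct (flipCoact comul) ζ.toLinearMap α.toLinearMap := by
    simp only [φ]
    rw [hG]
    ext g
    simp only [flipCoact, convAct, LinearMap.comp_apply, AlgHom.toLinearMap_apply,
      AlgHom.comp_apply, Bialgebra.comulAlgHom_apply]
    induction comul (R := K) g with
    | zero => simp
    | add x y hx hy => simp only [map_add, hx, hy]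
    | tmul g b => simp [ζ, α]
  have hκ : convAct ρo.toLinearMap (μo.comp eA).toLinearMap (ζ.toLinearMap ∘ₗ antipode K) =
      κ.toLinearMap := by
    have hS : convAct comul ζ.toLinearMap (ζ.toLinearMap ∘ₗ antipode K) =
        Algebra.linearMap K (Ao ⊗[K] Zo) ∘ₗ counit := by
      rw [← compη ζ, ← mul_antipode_lTensor_comul]
      exact (algHom_comp_convAct ζ comul LinearMap.id (antipode K)).symm
    rw [hA', convAct_convAct hρ, hS, convAct_counit hρε]
  have assocL (f : Zo →ₗ[K] Ao ⊗[K] Zo) (g g' : G →ₗ[K] Ao ⊗[K] Zo) :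
      convAct L (convAct L f g) g' = convAct L f (convAct (flipCoact comul) g g') :=
    convAct_convAct (flipCoact_coassoc (lam := lamo.toLinearMap) hlam) f g g'
  have unitL (f : Zo →ₗ[K] Ao ⊗[K] Zo) :
      convAct L f (Algebra.linearMap K (Ao ⊗[K] Zo) ∘ₗ (counit : G →ₗ[K] K)) = f :=
    convAct_counit (flipCoact_counit (lam := lamo.toLinearMap) hlamε) f
  have cancel (f : G →ₐ[K] Ao ⊗[K] Zo) (x : Zo →ₗ[K] Ao ⊗[K] Zo) :
      convAct L (convAct L x (f.toLinearMap ∘ₗ Sinv)) f.toLinearMap = x ∧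
      convAct L (convAct L x f.toLinearMap) (f.toLinearMap ∘ₗ Sinv) = x := by
    have h1 := algHom_comp_convAct f (flipCoact comul) Sinv LinearMap.id
    have h2 := algHom_comp_convAct f (flipCoact comul) LinearMap.id Sinv
    rw [convAct_flip_antipodeInv_id hSinv, compη] at h1
    rw [convAct_flip_id_antipodeInv hSinv, compη] at h2
    rw [LinearMap.comp_id] at h1 h2
    rw [assocL, assocL, ← h1, ← h2, unitL]
    exact ⟨rfl, rfl⟩
  have hι : convAct L (μo.comp eZ).toLinearMap
      (convAct (flipCoact comul) (φ.toLinearMap ∘ₗ Sinv) ζ.toLinearMap) = ι.toLinearMap := by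
    have h : (μo.comp eZ).toLinearMap =
        convAct L (convAct L ι.toLinearMap (ζ.toLinearMap ∘ₗ Sinv)) φ.toLinearMap := by
      rw [hG', ← assocL, (cancel ζ _).1, hZ']
    rw [← assocL, h, (cancel φ _).2, (cancel ζ _).1]
  induction v with
  | zero => simp
  | add x y hx hy => simp only [map_add, hx, hy]
  | tmul a b =>
    rw [iMap_jMap_tmul ρo lamo μo eA eZ eG Sinv eGZ hκ]
    refine (congrArg (· * a ⊗ₜ[K] (1 : Zo)) (LinearMap.congr_fun hι b)).trans ?_
    simp [ι]

end Composition

/-- (case `m = n > t`) the composition `i*_q ∘ j*_q` is the identity on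
`O_q(V°)`. -/
theorem stmt9 (K : Type) [Field K] (q : K) (hq : q ≠ 0) (n t : ℕ) (ht : 0 < t) (htn : t < n)
    -- `G` is the Hopf algebra `O_q(GL_t)`, the localization of `O_q(M_t)` at the central
    -- quantum determinant `d_T`:
    (G : Type) [Ring G] [HopfAlgebra K G]
    (ιG : OqM K q t t →ₐ[K] G)
    (hcentral : ∀ g : G, ιG (qdet K q t) * g = g * ιG (qdet K q t))
    (hunit : IsUnit (ιG (qdet K q t)))
    (huniv : ∀ (C : Type) [Ring C] [Algebra K C] (f : OqM K q t t →ₐ[K] C),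
      IsUnit (f (qdet K q t)) → ∃! g : G →ₐ[K] C, g.comp ιG = f)
    -- the Hopf structure of `G` on the generators `T_{ij} = ιG X_{ij}`:
    (hΔT : ∀ i j : Fin t, Coalgebra.comul (R := K) (ιG (Xg K q i j)) =
      ∑ k : Fin t, ιG (Xg K q i k) ⊗ₜ[K] ιG (Xg K q k j))
    (hεT : ∀ i j : Fin t, Coalgebra.counit (R := K) (ιG (Xg K q i j)) =
      if i = j then (1 : K) else 0)
    -- the right coaction `ρ*_q` of `G` on `O_q(M_{n,t})`, `Y_{ij} ↦ Σ_k Y_{ik} ⊗ T_{kj}`: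
    (ρ : OqM K q n t →ₐ[K] OqM K q n t ⊗[K] G)
    (hρ : ∀ (i : Fin n) (j : Fin t),
      ρ (Xg K q i j) = ∑ k : Fin t, Xg K q i k ⊗ₜ[K] ιG (Xg K q k j))
    -- the left coaction `λ*_q` of `G` on `O_q(M_{t,n})`, `Z_{ij} ↦ Σ_k T_{ik} ⊗ Z_{kj}`:
    (lam : OqM K q t n →ₐ[K] G ⊗[K] OqM K q t n)
    (hlam : ∀ (i : Fin t) (j : Fin n),
      lam (Xg K q i j) = ∑ k : Fin t, ιG (Xg K q i k) ⊗ₜ[K] Xg K q k j)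
    -- `Ao = O_q(M_{n,t}°) = O_q(M_{n,t})[d_Y⁻¹]`:
    (Ao : Type) [Ring Ao] [Algebra K Ao] (ιY : OqM K q n t →ₐ[K] Ao)
    (hYunit : IsUnit (ιY (dY K q n t htn.le)))
    (hYuniv : ∀ (C : Type) [Ring C] [Algebra K C] (f : OqM K q n t →ₐ[K] C),
      IsUnit (f (dY K q n t htn.le)) → ∃! g : Ao →ₐ[K] C, g.comp ιY = f)
    -- `Zo = O_q(M_{t,n}°) = O_q(M_{t,n})[d_Z⁻¹]`:
    (Zo : Type) [Ring Zo] [Algebra K Zo] (ιZ : OqM K q t n →ₐ[K] Zo)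
    (hZunit : IsUnit (ιZ (dZ K q n t htn.le)))
    (hZuniv : ∀ (C : Type) [Ring C] [Algebra K C] (f : OqM K q t n →ₐ[K] C),
      IsUnit (f (dZ K q n t htn.le)) → ∃! g : Zo →ₐ[K] C, g.comp ιZ = f)
    -- `Xo = O_q(M_n^{≤t,°}) = O_q(M_n^{≤t})[d_x⁻¹]`:
    (Xo : Type) [Ring Xo] [Algebra K Xo] (ιX : OqMle K q n n t →ₐ[K] Xo)
    (hxunit : IsUnit (ιX (dx K q n t htn.le)))
    (hXuniv : ∀ (C : Type) [Ring C] [Algebra K C] (f : OqMle K q n n t →ₐ[K] C),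
      IsUnit (f (dx K q n t htn.le)) → ∃! g : Xo →ₐ[K] C, g.comp ιX = f)
    -- the localized coactions `ρ°*_q` and `λ°*_q`:
    (ρo : Ao →ₐ[K] Ao ⊗[K] G)
    (hρo : ρo.comp ιY = (Algebra.TensorProduct.map ιY (AlgHom.id K G)).comp ρ)
    (lamo : Zo →ₐ[K] G ⊗[K] Zo)
    (hlamo : lamo.comp ιZ = (Algebra.TensorProduct.map (AlgHom.id K G) ιZ).comp lam)
    -- `μ*_q : O_q(M_n^{≤t}) → O_q(M_{n,t}) ⊗ O_q(M_{t,n})` and its localized extension `μ°*_q`: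
    (μ : OqMle K q n n t →ₐ[K] OqM K q n t ⊗[K] OqM K q t n)
    (hμ : ∀ (i j : Fin n),
      μ (mkle K q n n t (Xg K q i j)) = ∑ k : Fin t, Xg K q i k ⊗ₜ[K] Xg K q k j)
    (μo : Xo →ₐ[K] Ao ⊗[K] Zo)
    (hμo : μo.comp ιX = (Algebra.TensorProduct.map ιY ιZ).comp μ)
    -- the lower-left-corner embeddings (`inj` in the paper):
    (eA : Ao →ₐ[K] Xo)
    (heA : ∀ (i : Fin n) (j : Fin t), eA (ιY (Xg K q i j)) =
      ιX (mkle K q n n t (Xg K q i (colLeft n t htn.le j))))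
    (eZ : Zo →ₐ[K] Xo)
    (heZ : ∀ (i : Fin t) (j : Fin n), eZ (ιZ (Xg K q i j)) =
      ιX (mkle K q n n t (Xg K q (rowTop n t htn.le i) j)))
    (eG : G →ₐ[K] Xo)
    (heG : ∀ i j : Fin t, eG (ιG (Xg K q i j)) =
      ιX (mkle K q n n t (Xg K q (rowTop n t htn.le i) (colLeft n t htn.le j))))
    -- the antipode of `O_q(GL_t)` is bijective, with inverse `Sinv`:
    (Sinv : G →ₗ[K] G)
    (hSinv : ∀ g : G, Sinv (HopfAlgebra.antipode (R := K) g) = g ∧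
      HopfAlgebra.antipode (R := K) (Sinv g) = g)
    -- the embedding of `O_q(GL_t)` into `O_q(M_{t,n}°)`, `T_{ij} ↦ Z_{ij}`:
    (eGZ : G →ₐ[K] Zo)
    (heGZ : ∀ i j : Fin t, eGZ (ιG (Xg K q i j)) = ιZ (Xg K q i (colLeft n t htn.le j)))
    :
    ∀ v : Ao ⊗[K] Zo,
      iMap K G Ao Zo Xo μo eGZ (jMap K G Ao Zo Xo ρo lamo eA eZ eG Sinv v) = v := by
  have hρX : ∀ i j, ρo (ιY (Xg K q i j)) = ∑ k, ιY (Xg K q i k) ⊗ₜ[K] ιG (Xg K q k j) := by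
    intro i j
    simpa [hρ] using AlgHom.congr_fun hρo (Xg K q i j)
  have hlamX : ∀ i j, lamo (ιZ (Xg K q i j)) = ∑ k, ιG (Xg K q i k) ⊗ₜ[K] ιZ (Xg K q k j) := by
    intro i j
    simpa [hlam] using AlgHom.congr_fun hlamo (Xg K q i j)
  have hμX : ∀ i j, μo (ιX (mkle K q n n t (Xg K q i j))) =
      ∑ k, ιY (Xg K q i k) ⊗ₜ[K] ιZ (Xg K q k j) := by
    intro i j
    simpa [hμ] using AlgHom.congr_fun hμo (mkle K q n n t (Xg K q i j))
  have hr := rowTop_strictMono n t htn.le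
  obtain ⟨eGY, heGY, -⟩ := huniv Ao (ιY.comp (OqM.mapRows K q t _ hr)) (by
    rw [qdet, AlgHom.comp_apply, OqM.mapRows_qMinor]
    exact hYunit)
  replace heGY : ∀ i j, eGY (ιG (Xg K q i j)) = ιY (Xg K q (rowTop n t htn.le i) j) := by
    intro i j
    simpa using AlgHom.congr_fun heGY (Xg K q i j)
  refine iMap_jMap ρo lamo μo eA eZ eG Sinv eGY eGZ hSinv ?_ ?_ ?_ ?_ ?_ ?_ ?_
  · refine AlgHom.congr_fun (localization_algHom_ext
      (f := (Algebra.TensorProduct.assoc K K K Ao G G).toAlgHom.comp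
        ((Algebra.TensorProduct.map ρo (AlgHom.id K G)).comp ρo))
      (g := (Algebra.TensorProduct.map (AlgHom.id K Ao) (Bialgebra.comulAlgHom K G)).comp ρo)
      hYunit hYuniv fun i j => ?_)
    simp only [AlgHom.comp_apply, hρX, map_sum, Algebra.TensorProduct.map_tmul,
      Bialgebra.comulAlgHom_apply, hΔT, TensorProduct.sum_tmul, TensorProduct.tmul_sum]
    rw [Finset.sum_comm]
    simp
  · refine AlgHom.congr_fun (localization_algHom_ext
      (f := (Algebra.TensorProduct.map (AlgHom.id K Ao) (Bialgebra.counitAlgHom K G)).comp ρo)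
      (g := Algebra.TensorProduct.includeLeft) hYunit hYuniv fun i j => ?_)
    simp [hρX, hεT, TensorProduct.tmul_ite]
  · refine AlgHom.congr_fun (localization_algHom_ext
      (f := (Algebra.TensorProduct.assoc K K K G G Zo).toAlgHom.comp
        ((Algebra.TensorProduct.map (Bialgebra.comulAlgHom K G) (AlgHom.id K Zo)).comp lamo))
      (g := (Algebra.TensorProduct.map (AlgHom.id K G) lamo).comp lamo)
      hZunit hZuniv fun i j => ?_)
    simp only [AlgHom.comp_apply, hlamX, map_sum, Algebra.TensorProduct.map_tmul,
      Bialgebra.comulAlgHom_apply, hΔT, TensorProduct.sum_tmul, TensorProduct.tmul_sum]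
    rw [Finset.sum_comm]
    simp
  · refine AlgHom.congr_fun (localization_algHom_ext
      (f := (Algebra.TensorProduct.map (Bialgebra.counitAlgHom K G) (AlgHom.id K Zo)).comp lamo)
      (g := Algebra.TensorProduct.includeRight) hZunit hZuniv fun i j => ?_)
    simp [hlamX, hεT, TensorProduct.ite_tmul]
  · refine localization_algHom_ext hYunit hYuniv fun i j => ?_
    simp [heA, hμX, hρX, heGZ]
  · refine localization_algHom_ext hZunit hZuniv fun i j => ?_
    simp [heZ, hμX, hlamX, heGY]
  · refine localization_algHom_ext hunit huniv fun i j => ?_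
    simp [heG, hμX, hΔT, heGY, heGZ]

end
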